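/- arXiv:2408.09561 — 2 statements merged into one kernel-verified Lean document; each statement's English description precedes it below -/
import Mathlib

section
/- Suppose the characteristic polynomial p(x) = x² − a·x − b of Q has two distinct roots γ₁, γ₂ in 𝔽_q, and set r = ord(−b), m = ord(γ₁), n = ord(γ₂) with m ≤ n. Then: (a) if r divides m, every nonzero vector in 𝔽_q² has orbit length m; (b) if gcd(r, m) = 1, every nonzero vector in 𝔽_q² has orbit length m or r·m, and both lengths occur. -/
open Matrix

/-- The least positive element of a set of multiples of `k` is `k`. -/
lemma isLeast_pos_of_iff_dvd {P : ℕ → Prop} {k : ℕ} (hk : 0 < k) (h : ∀ l, P l ↔ k ∣ l) :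
    IsLeast {l : ℕ | 0 < l ∧ P l} k :=
  ⟨⟨hk, (h k).2 dvd_rfl⟩, fun l hl => Nat.le_of_dvd hl.1 ((h l).1 hl.2)⟩

/-- A nonzero element of a finite field has positive multiplicative order. -/
lemma orderOf_pos_of_ne_zero {F : Type*} [Field F] [Fintype F] {x : F} (hx : x ≠ 0) :
    0 < orderOf x := by
  rw [orderOf_pos_iff, isOfFinOrder_iff_pow_eq_one]
  exact ⟨Fintype.card F - 1, Nat.sub_pos_of_lt Fintype.one_lt_card,
    FiniteField.pow_card_sub_one_eq_one x hx⟩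

/-- Powers of a companion matrix act diagonally on combinations of its eigenvectors. -/
lemma companion_pow_mulVec {F : Type*} [Field F] {a b x y : F} (hsum : x + y = a)
    (hprod : x * y = -b) (c d : F) (l : ℕ) :
    !![a, b; 1, 0] ^ l *ᵥ ![c * x + d * y, c + d] =
      ![c * x ^ l * x + d * y ^ l * y, c * x ^ l + d * y ^ l] := by
  induction l with
  | zero => simp
  | succ k ih =>
    obtain rfl : b = -(x * y) := by rw [hprod, neg_neg]
    subst hsum
    rw [pow_succ', ← mulVec_mulVec, ih]
    ext i
    fin_cases i <;> simp <;> ring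

/-- A combination of eigenvectors is fixed by the `l`-th power of a companion matrix with distinct
eigenvalues iff every eigenvalue that occurs is an `l`-th root of unity. -/
lemma companion_pow_mulVec_eq_iff {F : Type*} [Field F] {a b x y : F} (hne : x ≠ y)
    (hsum : x + y = a) (hprod : x * y = -b) (c d : F) (l : ℕ) :
    !![a, b; 1, 0] ^ l *ᵥ ![c * x + d * y, c + d] = ![c * x + d * y, c + d] ↔
      (c = 0 ∨ orderOf x ∣ l) ∧ (d = 0 ∨ orderOf y ∣ l) := by
  rw [companion_pow_mulVec hsum hprod, orderOf_dvd_iff_pow_eq_one, orderOf_dvd_iff_pow_eq_one]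
  have hxy : x - y ≠ 0 := sub_ne_zero.2 hne
  constructor
  · intro h
    have h0 : c * x ^ l * x + d * y ^ l * y = c * x + d * y := congrFun h 0
    have h1 : c * x ^ l + d * y ^ l = c + d := congrFun h 1
    have hc : c * (x ^ l - 1) = 0 :=
      (mul_eq_zero.1 (by linear_combination h0 - y * h1 :
        (x - y) * (c * (x ^ l - 1)) = 0)).resolve_left hxy
    have hd : d * (y ^ l - 1) = 0 :=
      (mul_eq_zero.1 (by linear_combination x * h1 - h0 :
        (x - y) * (d * (y ^ l - 1)) = 0)).resolve_left hxy
    simpa only [mul_eq_zero, sub_eq_zero] using And.intro hc hd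
  · rintro ⟨rfl | hc, rfl | hd⟩ <;> simp [*]

/-- Every vector is a combination of the eigenvectors `![x, 1]` and `![y, 1]`. -/
lemma exists_eq_eigenvector_combination {F : Type*} [Field F] {x y : F} (hne : x ≠ y)
    (v : Fin 2 → F) : ∃ c d : F, v = ![c * x + d * y, c + d] := by
  have hxy : x - y ≠ 0 := sub_ne_zero.2 hne
  refine ⟨(v 0 - y * v 1) / (x - y), (x * v 1 - v 0) / (x - y), ?_⟩
  ext i
  fin_cases i <;> simp <;> field_simp <;> ring

/-- suppose `Q = !![a, b; 1, 0]` has distinct roots `γ₁, γ₂` over `𝔽_q`,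
and put `r = ord(-b)`, `m = ord(γ₁)`, `n = ord(γ₂)` with `m ≤ n`. Then
(a) if `r ∣ m`, every nonzero vector has orbit length `m`;
(b) if `gcd(r, m) = 1`, every nonzero vector has orbit length `m` or `r·m`, and both occur. -/
theorem orbit_lengths_distinct_roots {F : Type*} [Field F] [Fintype F]
    (a b : F) (hb : b ≠ 0)
    (Q : Matrix (Fin 2) (Fin 2) F) (hQ : Q = !![a, b; 1, 0])
    (γ₁ γ₂ : F) (hne : γ₁ ≠ γ₂) (hsum : γ₁ + γ₂ = a) (hprod : γ₁ * γ₂ = -b)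
    (r m n : ℕ) (hr : orderOf (-b) = r) (hm : orderOf γ₁ = m) (hn : orderOf γ₂ = n)
    (hmn : m ≤ n) :
    (r ∣ m → ∀ v : Fin 2 → F, v ≠ 0 →
      IsLeast {l : ℕ | 0 < l ∧ Q ^ l *ᵥ v = v} m) ∧
    (Nat.gcd r m = 1 →
      (∀ v : Fin 2 → F, v ≠ 0 →
        IsLeast {l : ℕ | 0 < l ∧ Q ^ l *ᵥ v = v} m ∨
        IsLeast {l : ℕ | 0 < l ∧ Q ^ l *ᵥ v = v} (r * m)) ∧
      (∃ v : Fin 2 → F, v ≠ 0 ∧ IsLeast {l : ℕ | 0 < l ∧ Q ^ l *ᵥ v = v} m) ∧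
      (∃ v : Fin 2 → F, v ≠ 0 ∧ IsLeast {l : ℕ | 0 < l ∧ Q ^ l *ᵥ v = v} (r * m))) := by
  subst hQ hr hm hn
  have h0 : γ₁ * γ₂ ≠ 0 := hprod ▸ neg_ne_zero.2 hb
  have hx : γ₁ ≠ 0 := left_ne_zero_of_mul h0
  have hy : γ₂ ≠ 0 := right_ne_zero_of_mul h0
  have hm0 := orderOf_pos_of_ne_zero hx
  have hn0 := orderOf_pos_of_ne_zero hy
  have key := companion_pow_mulVec_eq_iff hne hsum hprod
  rw [← hprod]
  constructor
  · intro hrm v hv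
    have hnm : orderOf γ₂ ∣ orderOf γ₁ := by
      rw [orderOf_dvd_iff_pow_eq_one] at hrm ⊢
      simpa [mul_pow, pow_orderOf_eq_one] using hrm
    have hord : orderOf γ₂ = orderOf γ₁ := le_antisymm (Nat.le_of_dvd hm0 hnm) hmn
    obtain ⟨c, d, rfl⟩ := exists_eq_eigenvector_combination hne v
    refine isLeast_pos_of_iff_dvd hm0 fun l => ?_
    rw [key, hord]
    by_cases hc : c = 0
    · by_cases hd : d = 0
      · exact absurd (by simp [hc, hd]) hv
      · simp [hc, hd]
    · simp only [hc, false_or]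
      exact ⟨And.left, fun h => ⟨h, Or.inr h⟩⟩
  · intro hrm
    have hinv : orderOf γ₁⁻¹ = orderOf γ₁ :=
      orderOf_eq_orderOf_iff.2 fun k => by rw [inv_pow, inv_eq_one]
    have hord : orderOf (γ₁ * γ₂) * orderOf γ₁ = orderOf γ₂ := by
      rw [← hinv, ← (Commute.all (γ₁ * γ₂) γ₁⁻¹).orderOf_mul_eq_mul_orderOf_of_coprime
        (by rwa [hinv])]
      congr 1
      field_simp
    have hdvd : orderOf γ₁ ∣ orderOf γ₂ := Dvd.intro_left _ hord
    rw [hord]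
    have length_left (c : F) (hc : c ≠ 0) : IsLeast {l : ℕ | 0 < l ∧
        !![a, b; 1, 0] ^ l *ᵥ ![c * γ₁ + 0 * γ₂, c + 0] = ![c * γ₁ + 0 * γ₂, c + 0]}
        (orderOf γ₁) :=
      isLeast_pos_of_iff_dvd hm0 fun l => by rw [key]; simp [hc]
    have length_right (c d : F) (hd : d ≠ 0) : IsLeast {l : ℕ | 0 < l ∧
        !![a, b; 1, 0] ^ l *ᵥ ![c * γ₁ + d * γ₂, c + d] = ![c * γ₁ + d * γ₂, c + d]}
        (orderOf γ₂) :=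
      isLeast_pos_of_iff_dvd hn0 fun l => by
        simp only [key, hd, false_or]
        exact ⟨And.right, fun h => ⟨Or.inr (hdvd.trans h), h⟩⟩
    refine ⟨fun v hv => ?_, ⟨_, ?_, length_left 1 one_ne_zero⟩,
      ⟨_, ?_, length_right 0 1 one_ne_zero⟩⟩
    · obtain ⟨c, d, rfl⟩ := exists_eq_eigenvector_combination hne v
      by_cases hd : d = 0
      · subst hd
        exact Or.inl (length_left c fun hc => hv (by simp [hc]))
      · exact Or.inr (length_right c d hd)
    · simp
    · simp
end

section
/- Let 𝔽_q have characteristic p and suppose the characteristic polynomial p(x) = x² − a·x − b of Q has a repeated root γ in 𝔽_q (i.e., a = 2γ and −b = γ²), and let l = ord(γ). Then the action of the cyclic group generated by Q on the nonzero vectors of 𝔽_q² has exactly (q−1)/l orbits of cardinality l and exactly q(q−1)/(p·l) orbits of cardinality p·l. -/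
open Matrix

open Function in
theorem ncard_range_iterate {α : Type*} {f : α → α} {x : α} (hx : x ∈ periodicPts f) :
    (Set.range fun n : ℕ => f^[n] x).ncard = minimalPeriod f x := by
  have h : (Set.range fun n : ℕ => f^[n] x) =
      (fun n : ℕ => f^[n] x) '' Set.Iio (minimalPeriod f x) := by
    ext y
    constructor
    · rintro ⟨n, rfl⟩
      exact ⟨n % minimalPeriod f x, Nat.mod_lt _ (minimalPeriod_pos_of_mem_periodicPts hx),
        iterate_mod_minimalPeriod_eq⟩
    · rintro ⟨n, -, rfl⟩
      exact ⟨n, rfl⟩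
  rw [h, iterate_injOn_Iio_minimalPeriod.ncard_image, ← Finset.coe_Iio,
    Set.ncard_coe_finset, Nat.card_Iio]

open Function in
theorem range_iterate_eq_of_mem {α : Type*} {f : α → α} {x y : α} (hx : x ∈ periodicPts f)
    (hy : y ∈ Set.range fun n : ℕ => f^[n] x) :
    (Set.range fun n : ℕ => f^[n] y) = Set.range fun n : ℕ => f^[n] x := by
  obtain ⟨m, rfl⟩ := hy
  ext z
  constructor
  · rintro ⟨n, rfl⟩
    exact ⟨n + m, iterate_add_apply f n m x⟩
  · rintro ⟨n, rfl⟩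
    have hpos := minimalPeriod_pos_of_mem_periodicPts hx
    have hle : m ≤ m * minimalPeriod f x := Nat.le_mul_of_pos_right m hpos
    refine ⟨n + (m * minimalPeriod f x - m), ?_⟩
    have hper : f^[m * minimalPeriod f x] x = x :=
      (isPeriodicPt_minimalPeriod f x).const_mul m
    simp only
    rw [← iterate_add_apply, add_assoc, Nat.sub_add_cancel hle, iterate_add_apply, hper]

open Function in
/-- An invariant set of points of positive minimal period `k` splits into `|s| / k` orbits. -/
theorem ncard_image_range_iterate {α : Type*} [Finite α] {f : α → α} {k : ℕ} (hk : 0 < k)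
    {s : Set α} (hs : ∀ x ∈ s, minimalPeriod f x = k) (hinv : ∀ x ∈ s, f x ∈ s) :
    ((fun x => Set.range fun n : ℕ => f^[n] x) '' s).ncard = s.ncard / k := by
  classical
  have := Fintype.ofFinite α
  have hper : ∀ x ∈ s, x ∈ periodicPts f := fun x hx =>
    minimalPeriod_pos_iff_mem_periodicPts.1 (by rw [hs x hx]; exact hk)
  have hmem : ∀ x ∈ s, ∀ n : ℕ, f^[n] x ∈ s := fun x hx n => by
    induction n with
    | zero => exact hx
    | succ n ih => rw [iterate_succ_apply']; exact hinv _ ih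
  set O : α → Set α := fun x => Set.range fun n : ℕ => f^[n] x
  have hcard : s.toFinset.card = (s.toFinset.image O).card * k := by
    rw [Finset.card_eq_sum_card_image O, Finset.sum_const_nat]
    intro S hS
    obtain ⟨x, hx, rfl⟩ := Finset.mem_image.1 hS
    rw [Set.mem_toFinset] at hx
    rw [← hs x hx, ← ncard_range_iterate (hper x hx), ← Set.ncard_coe_finset]
    congr 1
    ext y
    simp only [Finset.coe_filter, Set.mem_toFinset, Set.mem_ofPred_eq]
    constructor
    · rintro ⟨-, hy⟩
      exact hy.subset (show y ∈ O y from ⟨0, rfl⟩)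
    · intro hy
      refine ⟨?_, range_iterate_eq_of_mem (hper x hx) hy⟩
      obtain ⟨n, rfl⟩ := hy
      exact hmem x hx n
  have h1 : (O '' s).ncard = (s.toFinset.image O).card := by
    rw [← Set.ncard_coe_finset]
    simp
  rw [h1, Set.ncard_eq_toFinset_card' s, hcard, Nat.mul_div_cancel _ hk]

section RepeatedRoot

variable {F : Type*} [Field F]

/-- Powers of the companion matrix of `(x - γ) ^ 2`, applied to a vector. The functional
`v ↦ v 0 - γ * v 1` measures the failure of `v` to be an eigenvector. -/
theorem companion_pow_mulVec_s15 (γ : F) (v : Fin 2 → F) (n : ℕ) :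
    γ • (!![2 * γ, -γ ^ 2; 1, 0] ^ n *ᵥ v) =
      γ ^ n • (γ • v + (n * (v 0 - γ * v 1)) • ![γ, 1]) := by
  induction n with
  | zero => simp
  | succ n ih =>
    rw [pow_succ', ← Matrix.mulVec_mulVec, ← Matrix.mulVec_smul, ih]
    ext i
    fin_cases i <;> simp [vecHead, vecTail] <;> ring

theorem companion_pow_mulVec_eq_iff_s15 {γ : F} (hγ : γ ≠ 0) (v : Fin 2 → F) (hv : v ≠ 0) (n : ℕ) :
    !![2 * γ, -γ ^ 2; 1, 0] ^ n *ᵥ v = v ↔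
      γ ^ n = 1 ∧ (n : F) * (v 0 - γ * v 1) = 0 := by
  have hinj : !![2 * γ, -γ ^ 2; 1, 0] ^ n *ᵥ v = v ↔
      γ • (!![2 * γ, -γ ^ 2; 1, 0] ^ n *ᵥ v) = γ • v := (smul_right_injective _ hγ).eq_iff.symm
  rw [hinj, companion_pow_mulVec_s15]
  constructor
  · intro h
    have h0 := congrFun h 0
    have h1 := congrFun h 1
    simp [vecHead, vecTail] at h0 h1
    have hd : (γ ^ n - 1) * (v 0 - γ * v 1) = 0 := by
      refine mul_left_cancel₀ hγ ?_
      linear_combination h0 - γ * h1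
    have hpow : γ ^ n = 1 := by
      rcases mul_eq_zero.1 hd with h | h
      · exact sub_eq_zero.1 h
      · rw [h, mul_zero, add_zero] at h1
        have hv1 : v 1 ≠ 0 := fun h' => hv <| by
          rw [h', mul_zero, sub_zero] at h
          ext i
          fin_cases i
          · exact h
          · exact h'
        refine mul_right_cancel₀ (mul_ne_zero hγ hv1) ?_
        rw [h1, one_mul]
    refine ⟨hpow, ?_⟩
    rw [hpow] at h1
    linear_combination h1
  · rintro ⟨hpow, h⟩
    rw [hpow, h, zero_smul, add_zero, one_smul]

theorem iterate_mulVec (M : Matrix (Fin 2) (Fin 2) F) (v : Fin 2 → F) (n : ℕ) :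
    (fun w => M *ᵥ w)^[n] v = M ^ n *ᵥ v := by
  induction n with
  | zero => simp
  | succ n ih => rw [Function.iterate_succ_apply', ih, Matrix.mulVec_mulVec, pow_succ']

theorem minimalPeriod_companion_of_eq {γ : F} (hγ : γ ≠ 0) {v : Fin 2 → F} (hv : v ≠ 0)
    (hd : v 0 - γ * v 1 = 0) :
    Function.minimalPeriod (fun w => !![2 * γ, -γ ^ 2; 1, 0] *ᵥ w) v = orderOf γ := by
  refine Nat.dvd_right_iff_eq.1 fun n => ?_
  rw [← Function.isPeriodicPt_iff_minimalPeriod_dvd, Function.IsPeriodicPt, Function.IsFixedPt,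
    iterate_mulVec, companion_pow_mulVec_eq_iff_s15 hγ v hv, hd, orderOf_dvd_iff_pow_eq_one]
  simp

theorem coprime_orderOf_of_charP [Finite F] (p : ℕ) [CharP F p] {γ : F} (hγ : γ ≠ 0) :
    p.Coprime (orderOf γ) := by
  have := Fintype.ofFinite F
  have hp : p.Prime := CharP.char_is_prime F p
  refine hp.coprime_iff_not_dvd.2 fun h => ?_
  have h1 : p ∣ Fintype.card F - 1 :=
    h.trans (orderOf_dvd_of_pow_eq_one (FiniteField.pow_card_sub_one_eq_one γ hγ))
  have h2 : p ∣ Fintype.card F :=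
    (CharP.cast_eq_zero_iff F p _).1 (FiniteField.cast_card_eq_zero F)
  have h3 := (Nat.dvd_sub_iff_right Fintype.card_pos h2).1 h1
  exact hp.one_lt.ne' (Nat.dvd_one.1 h3)

theorem minimalPeriod_companion_of_ne [Finite F] (p : ℕ) [CharP F p] {γ : F} (hγ : γ ≠ 0)
    {v : Fin 2 → F} (hd : v 0 - γ * v 1 ≠ 0) :
    Function.minimalPeriod (fun w => !![2 * γ, -γ ^ 2; 1, 0] *ᵥ w) v = p * orderOf γ := by
  have hv : v ≠ 0 := by
    rintro rfl
    simp at hd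
  refine Nat.dvd_right_iff_eq.1 fun n => ?_
  rw [← Function.isPeriodicPt_iff_minimalPeriod_dvd, Function.IsPeriodicPt, Function.IsFixedPt,
    iterate_mulVec, companion_pow_mulVec_eq_iff_s15 hγ v hv, mul_eq_zero_iff_right hd,
    CharP.cast_eq_zero_iff F p, ← orderOf_dvd_iff_pow_eq_one]
  exact ⟨fun h => (coprime_orderOf_of_charP p hγ).mul_dvd_of_dvd_of_dvd h.2 h.1,
    fun h => ⟨dvd_of_mul_left_dvd h, dvd_of_mul_right_dvd h⟩⟩

theorem ncard_eigenline [Fintype F] (γ : F) :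
    {v : Fin 2 → F | v ≠ 0 ∧ v 0 - γ * v 1 = 0}.ncard = Fintype.card F - 1 := by
  have h : {v : Fin 2 → F | v ≠ 0 ∧ v 0 - γ * v 1 = 0} =
      (fun c : F => ![γ * c, c]) '' {0}ᶜ := by
    ext v
    constructor
    · rintro ⟨hv, hd⟩
      have hv0 : v 0 = γ * v 1 := sub_eq_zero.1 hd
      have hvec : ![γ * v 1, v 1] = v := by
        ext i
        fin_cases i <;> simp [hv0]
      refine ⟨v 1, fun h => hv ?_, hvec⟩
      rw [Set.mem_singleton_iff] at h
      rw [← hvec, h]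
      simp
    · rintro ⟨c, hc, rfl⟩
      exact ⟨fun h => hc (congrFun h 1), by simp⟩
  rw [h, Set.ncard_image_of_injective _ fun x y hxy => congrFun hxy 1, Set.ncard_compl,
    Set.ncard_singleton, Nat.card_eq_fintype_card]

theorem ncard_compl_eigenline [Fintype F] (γ : F) :
    {v : Fin 2 → F | v 0 - γ * v 1 ≠ 0}.ncard = Fintype.card F * (Fintype.card F - 1) := by
  have h : {v : Fin 2 → F | v 0 - γ * v 1 ≠ 0} =
      (fun c : F × F => ![c.2 + γ * c.1, c.1]) '' (Set.univ ×ˢ {0}ᶜ) := by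
    ext v
    constructor
    · intro hd
      refine ⟨(v 1, v 0 - γ * v 1), ⟨Set.mem_univ _, hd⟩, ?_⟩
      ext i
      fin_cases i <;> simp
    · rintro ⟨c, hc, rfl⟩
      simpa using hc
  have hinj : Function.Injective fun c : F × F => ![c.2 + γ * c.1, c.1] := fun x y hxy => by
    have h1 : x.1 = y.1 := congrFun hxy 1
    have h0 : x.2 + γ * x.1 = y.2 + γ * y.1 := congrFun hxy 0
    rw [h1] at h0
    exact Prod.ext h1 (add_right_cancel h0)
  rw [h, Set.ncard_image_of_injective _ hinj, Set.ncard_prod, Set.ncard_univ, Set.ncard_compl,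
    Set.ncard_singleton, Nat.card_eq_fintype_card]

end RepeatedRoot

/-- let `𝔽_q` have characteristic `p` and suppose the characteristic
polynomial of `Q = !![a, b; 1, 0]` has a repeated root `γ` (i.e. `a = 2γ`, `-b = γ²`),
with `l = ord(γ)`. Then there are exactly `(q-1)/l` orbits of cardinality `l` and
exactly `q(q-1)/(p·l)` orbits of cardinality `p·l` on the nonzero vectors. -/
theorem number_of_orbits_repeated_root {F : Type*} [Field F] [Fintype F]
    (p : ℕ) (hchar : CharP F p)
    (a b : F) (hb : b ≠ 0)
    (Q : Matrix (Fin 2) (Fin 2) F) (hQ : Q = !![a, b; 1, 0])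
    (γ : F) (ha : a = 2 * γ) (hbγ : -b = γ ^ 2)
    (l : ℕ) (hl : orderOf γ = l)
    (q : ℕ) (hq : q = Fintype.card F) :
    {S : Set (Fin 2 → F) | ∃ v : Fin 2 → F, v ≠ 0 ∧
        S = Set.range (fun n : ℕ => Q ^ n *ᵥ v) ∧ S.ncard = l}.ncard = (q - 1) / l ∧
    {S : Set (Fin 2 → F) | ∃ v : Fin 2 → F, v ≠ 0 ∧
        S = Set.range (fun n : ℕ => Q ^ n *ᵥ v) ∧ S.ncard = p * l}.ncard
      = q * (q - 1) / (p * l) := by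
  classical
  subst hl hq ha
  obtain rfl : b = -γ ^ 2 := by rw [← hbγ, neg_neg]
  subst hQ
  have hγ : γ ≠ 0 := fun h => hb (by simp [h])
  have hp : p.Prime := CharP.char_is_prime F p
  have hl : 0 < orderOf γ := (isOfFinOrder_iff_pow_eq_one.2 ⟨Fintype.card F - 1,
    Nat.sub_pos_of_lt Fintype.one_lt_card, FiniteField.pow_card_sub_one_eq_one γ hγ⟩).orderOf_pos
  have hlt : orderOf γ < p * orderOf γ := lt_mul_left hl hp.one_lt
  set f : (Fin 2 → F) → (Fin 2 → F) := fun w => !![2 * γ, -γ ^ 2; 1, 0] *ᵥ w with hf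
  have hper (v : Fin 2 → F) (hv : v ≠ 0) :
      Function.minimalPeriod f v = if v 0 - γ * v 1 = 0 then orderOf γ else p * orderOf γ := by
    split_ifs with hd
    · exact minimalPeriod_companion_of_eq hγ hv hd
    · exact minimalPeriod_companion_of_ne p hγ hd
  have hncard (v : Fin 2 → F) (hv : v ≠ 0) : (Set.range fun n : ℕ => f^[n] v).ncard =
      if v 0 - γ * v 1 = 0 then orderOf γ else p * orderOf γ := by
    rw [← hper v hv]
    refine ncard_range_iterate (Function.minimalPeriod_pos_iff_mem_periodicPts.1 ?_)
    rw [hper v hv]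
    split_ifs <;> omega
  have hfd (v : Fin 2 → F) : f v 0 - γ * f v 1 = γ * (v 0 - γ * v 1) := by
    simp [hf, vecHead, vecTail]
    ring
  have hf0 (v : Fin 2 → F) (hv : v ≠ 0) : f v ≠ 0 := fun h => hv <| by
    have h0 := congrFun h 0
    have h1 := congrFun h 1
    simp [hf, vecHead, vecTail] at h0 h1
    ext i
    fin_cases i
    · exact h1
    · simpa [h1, hγ] using h0
  simp_rw [← iterate_mulVec, ← hf]
  constructor
  · rw [← ncard_eigenline γ, ← ncard_image_range_iterate (f := f) hl
      (s := {v | v ≠ 0 ∧ v 0 - γ * v 1 = 0})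
      (fun v hv => minimalPeriod_companion_of_eq hγ hv.1 hv.2)
      (fun v hv => ⟨hf0 v hv.1, by rw [hfd, hv.2, mul_zero]⟩)]
    congr 1
    ext S
    constructor
    · rintro ⟨v, hv, rfl, hS⟩
      refine ⟨v, ⟨hv, ?_⟩, rfl⟩
      rw [hncard v hv] at hS
      by_contra hd
      rw [if_neg hd] at hS
      omega
    · rintro ⟨v, ⟨hv, hd⟩, rfl⟩
      exact ⟨v, hv, rfl, by rw [hncard v hv, if_pos hd]⟩
  · rw [← ncard_compl_eigenline γ, ← ncard_image_range_iterate (f := f) (hl.trans hlt)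
      (s := {v | v 0 - γ * v 1 ≠ 0})
      (fun v hv => minimalPeriod_companion_of_ne p hγ hv)
      (fun v hv => by rw [Set.mem_ofPred_eq, hfd]; exact mul_ne_zero hγ hv)]
    congr 1
    ext S
    constructor
    · rintro ⟨v, hv, rfl, hS⟩
      refine ⟨v, fun hd => ?_, rfl⟩
      rw [hncard v hv, if_pos hd] at hS
      omega
    · rintro ⟨v, hd, rfl⟩
      have hv : v ≠ 0 := by
        rintro rfl
        simp at hd
      exact ⟨v, hv, rfl, by rw [hncard v hv, if_neg hd]⟩
end
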